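/- Let (X,Y) and (X',Y') be i.i.d. pairs of ℤ-valued random variables ((X,Y) independent of (X',Y') and with the same joint distribution) with finite conditional entropy H(X|Y) = c. Then H(X+X' | Y,Y') − c ≥ g̃(c), where g̃(c) = min_{δ∈[0,1/2]} max( g(c,c) − h₂(δ) , δ²·g(c,c) ), and g(c,d) = (1/2) · min_{(x,y)∈[0,1]²} max( d·x − h₂(x) + c·y − h₂(y) , l(x,y) ), with l(x,y) = min_{(a,b)∈T(x,y)} ((1−x)²a² + (1−y)²b²)/(8 ln 2) and T(x,y) = {(a,b) ∈ ℝ₊² : a ≥ (4y−2)⁺, b ≥ (4x−2)⁺, a+b ≥ 2−x−y}. Moreover g̃ is increasing and g̃(c) = 0 if and only if c = 0. -/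

import Mathlib

open MeasureTheory ProbabilityTheory

/-- Binary entropy function (in bits), with the convention `0 * log₂ 0 = 0`. -/
noncomputable def H2 (x : ℝ) : ℝ := -(x * Real.logb 2 x) - (1 - x) * Real.logb 2 (1 - x)

/-- The constraint set `T(x,y) = {(a,b) ∈ ℝ₊² : a ≥ (4y−2)⁺, b ≥ (4x−2)⁺, a+b ≥ 2−x−y}`. -/
def Tset (x y : ℝ) : Set (ℝ × ℝ) :=
  {ab | 0 ≤ ab.1 ∧ 0 ≤ ab.2 ∧ max (4 * y - 2) 0 ≤ ab.1 ∧ max (4 * x - 2) 0 ≤ ab.2 ∧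
    2 - x - y ≤ ab.1 + ab.2}

/-- `l(x,y) = min_{(a,b) ∈ T(x,y)} ((1−x)²a² + (1−y)²b²)/(8 ln 2)`. -/
noncomputable def lfun (x y : ℝ) : ℝ :=
  sInf ((fun ab : ℝ × ℝ => ((1 - x) ^ 2 * ab.1 ^ 2 + (1 - y) ^ 2 * ab.2 ^ 2) / (8 * Real.log 2))
    '' Tset x y)

/-- `g(c,d) = (1/2)·min_{(x,y)∈[0,1]²} max( d·x − h₂(x) + c·y − h₂(y) , l(x,y) )`. -/
noncomputable def gNIID (c d : ℝ) : ℝ :=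
  (1 / 2) * sInf ((fun xy : ℝ × ℝ =>
      max (d * xy.1 - H2 xy.1 + c * xy.2 - H2 xy.2) (lfun xy.1 xy.2))
    '' (Set.Icc (0 : ℝ) 1 ×ˢ Set.Icc (0 : ℝ) 1))

/-- `g̃(c) = min_{δ∈[0,1/2]} max( g(c,c) − h₂(δ) , δ²·g(c,c) )`. -/
noncomputable def gTilde (c : ℝ) : ℝ :=
  sInf ((fun δ : ℝ => max (gNIID c c - H2 δ) (δ ^ 2 * gNIID c c)) '' Set.Icc (0 : ℝ) (1 / 2))

/-- Probability of an event, as a real number. -/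
noncomputable def pr {Ω : Type*} [MeasurableSpace Ω] (μ : Measure Ω) (A : Set Ω) : ℝ :=
  (μ A).toReal

/-- The `(k, b)`-summand of the conditional entropy `H(X|Y)` (in bits):
`−P(X=k, Y=b)·log₂( P(X=k, Y=b) / P(Y=b) )`. -/
noncomputable def condEntTerm {Ω β : Type*} [MeasurableSpace Ω] (μ : Measure Ω)
    (X : Ω → ℤ) (Y : Ω → β) (kb : ℤ × β) : ℝ :=
  -(pr μ {ω | X ω = kb.1 ∧ Y ω = kb.2} *
    Real.logb 2 (pr μ {ω | X ω = kb.1 ∧ Y ω = kb.2} / pr μ {ω | Y ω = kb.2}))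

/-- Conditional entropy `H(X|Y)` (in bits). -/
noncomputable def condEnt {Ω β : Type*} [MeasurableSpace Ω] (μ : Measure Ω)
    (X : Ω → ℤ) (Y : Ω → β) : ℝ :=
  ∑' kb : ℤ × β, condEntTerm μ X Y kb

/-- `H(X|Y) = c` with a convergent (finite) sum. -/
def CondEntIs {Ω β : Type*} [MeasurableSpace Ω] (μ : Measure Ω)
    (X : Ω → ℤ) (Y : Ω → β) (c : ℝ) : Prop :=
  HasSum (condEntTerm μ X Y) c


lemma H2_eq (x : ℝ) : H2 x = Real.binEntropy x / Real.log 2 := by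
  rw [Real.binEntropy_eq_negMulLog_add_negMulLog_one_sub]
  simp only [H2, Real.negMulLog, Real.logb]
  ring

lemma H2_cont : Continuous H2 := by
  have : H2 = fun x => Real.binEntropy x / Real.log 2 := funext H2_eq
  rw [this]
  exact Real.binEntropy_continuous.div_const _

lemma H2_zero : H2 0 = 0 := by simp [H2]
lemma H2_one : H2 1 = 0 := by simp [H2]
lemma H2_half : H2 (1 / 2) = 1 := by
  have h : Real.log 2 ≠ 0 := by positivity
  rw [H2_eq, one_div, Real.binEntropy_two_inv, div_self h]

lemma H2_nonneg {x : ℝ} (h0 : 0 ≤ x) (h1 : x ≤ 1) : 0 ≤ H2 x := by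
  rw [H2_eq]
  exact div_nonneg (Real.binEntropy_nonneg h0 h1) (Real.log_nonneg (by norm_num))

lemma l_bdd (x y : ℝ) : ∀ v ∈ ((fun ab : ℝ × ℝ =>
    ((1 - x) ^ 2 * ab.1 ^ 2 + (1 - y) ^ 2 * ab.2 ^ 2) / (8 * Real.log 2)) '' Tset x y), 0 ≤ v := by
  rintro v ⟨ab, -, rfl⟩
  have : 0 < Real.log 2 := Real.log_pos (by norm_num)
  dsimp only
  positivity

lemma lfun_nonneg (x y : ℝ) : 0 ≤ lfun x y := Real.sInf_nonneg (l_bdd x y)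

lemma lfun_le {x y a b : ℝ} (h : (a, b) ∈ Tset x y) :
    lfun x y ≤ ((1 - x) ^ 2 * a ^ 2 + (1 - y) ^ 2 * b ^ 2) / (8 * Real.log 2) :=
  csInf_le ⟨0, l_bdd x y⟩ ⟨(a, b), h, rfl⟩

lemma Tset_nonempty (x y : ℝ) : (Tset x y).Nonempty := by
  refine ⟨(max (max (4 * y - 2) 0) (2 - x - y), max (4 * x - 2) 0), ?_⟩
  simp only [Tset, Set.mem_ofPred_eq]
  refine ⟨by simp, by simp, by simp, le_rfl, ?_⟩
  have h1 := le_max_right (max (4 * y - 2) 0) (2 - x - y)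
  have h2 := le_max_right (4 * x - 2) 0
  linarith

lemma le_lfun {x y v : ℝ}
    (h : ∀ a b, (a, b) ∈ Tset x y →
      v ≤ ((1 - x) ^ 2 * a ^ 2 + (1 - y) ^ 2 * b ^ 2) / (8 * Real.log 2)) : v ≤ lfun x y := by
  apply le_csInf ((Tset_nonempty x y).image _)
  rintro _ ⟨⟨a, b⟩, hab, rfl⟩
  exact h a b hab

/-- the objective inside `g` -/
noncomputable def gobj (c d x y : ℝ) : ℝ :=
  max (d * x - H2 x + c * y - H2 y) (lfun x y)

lemma gobj_nonneg (c d x y : ℝ) : 0 ≤ gobj c d x y := le_max_of_le_right (lfun_nonneg x y)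

lemma gNIID_le {c d x y : ℝ} (hx : 0 ≤ x) (hx1 : x ≤ 1) (hy : 0 ≤ y) (hy1 : y ≤ 1) :
    gNIID c d ≤ 1 / 2 * gobj c d x y := by
  unfold gNIID
  gcongr
  refine csInf_le ⟨0, ?_⟩ ⟨(x, y), ⟨⟨hx, hx1⟩, ⟨hy, hy1⟩⟩, rfl⟩
  rintro _ ⟨z, -, rfl⟩
  exact gobj_nonneg c d z.1 z.2

lemma le_gNIID {c d v : ℝ} (h : ∀ x y, 0 ≤ x → x ≤ 1 → 0 ≤ y → y ≤ 1 → v ≤ 1 / 2 * gobj c d x y) :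
    v ≤ gNIID c d := by
  unfold gNIID
  have : 2 * v ≤ sInf ((fun xy : ℝ × ℝ =>
      max (d * xy.1 - H2 xy.1 + c * xy.2 - H2 xy.2) (lfun xy.1 xy.2))
    '' (Set.Icc (0 : ℝ) 1 ×ˢ Set.Icc (0 : ℝ) 1)) := by
    apply le_csInf
    · exact ⟨_, ⟨(0, 0), by simp, rfl⟩⟩
    · rintro _ ⟨⟨x, y⟩, ⟨⟨h1, h2⟩, h3, h4⟩, rfl⟩
      have := h x y h1 h2 h3 h4
      unfold gobj at this
      dsimp only
      linarith
  linarith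

lemma gNIID_nonneg (c d : ℝ) : 0 ≤ gNIID c d :=
  le_gNIID fun x y _ _ _ _ => by have := gobj_nonneg c d x y; linarith

lemma gNIID_lip (c c1 c2 : ℝ) :
    gNIID c c - (max (c - c1) 0 + max (c - c2) 0) / 2 ≤ gNIID c1 c2 := by
  apply le_gNIID
  intro x y hx hx1 hy hy1
  have h := gNIID_le (c := c) (d := c) hx hx1 hy hy1
  have : gobj c c x y ≤ gobj c1 c2 x y + (max (c - c1) 0 + max (c - c2) 0) := by
    have h1 := le_max_left (c - c1) 0
    have h2 := le_max_left (c - c2) 0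
    have h3 := le_max_right (c - c1) 0
    have h4 := le_max_right (c - c2) 0
    have h5 := le_max_left (c2 * x - H2 x + c1 * y - H2 y) (lfun x y)
    have h6 := le_max_right (c2 * x - H2 x + c1 * y - H2 y) (lfun x y)
    unfold gobj
    apply max_le
    · nlinarith
    · linarith
  linarith

lemma gNIID_mono {c c' : ℝ} (h : c ≤ c') : gNIID c c ≤ gNIID c' c' := by
  have := gNIID_lip c c' c'
  rwa [max_eq_right (by linarith), add_zero, zero_div, sub_zero] at this

lemma gNIID_le_one (c d : ℝ) : gNIID c d ≤ 1 := by
  have h := gNIID_le (c := c) (d := d) (x := 0) (y := 0) le_rfl zero_le_one le_rfl zero_le_one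
  have hl : lfun 0 0 ≤ 1 := by
    refine (lfun_le (a := 1) (b := 1) ?_).trans ?_
    · simp only [Tset, Set.mem_ofPred_eq]; norm_num
    · have := Real.log_two_gt_d9
      rw [div_le_one (by positivity)]; linarith
  have : gobj c d 0 0 ≤ 1 := by
    unfold gobj
    rw [H2_zero]
    apply max_le
    · norm_num
    · exact hl
  linarith

lemma gT_bdd (c : ℝ) : ∀ v ∈ ((fun δ : ℝ => max (gNIID c c - H2 δ) (δ ^ 2 * gNIID c c)) ''
    Set.Icc (0 : ℝ) (1 / 2)), 0 ≤ v := by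
  rintro _ ⟨δ, -, rfl⟩
  exact le_max_of_le_right (mul_nonneg (sq_nonneg _) (gNIID_nonneg c c))

lemma gTilde_nonneg (c : ℝ) : 0 ≤ gTilde c := Real.sInf_nonneg (gT_bdd c)

lemma gTilde_le {c δ : ℝ} (h0 : 0 ≤ δ) (h1 : δ ≤ 1 / 2) :
    gTilde c ≤ max (gNIID c c - H2 δ) (δ ^ 2 * gNIID c c) :=
  csInf_le ⟨0, gT_bdd c⟩ ⟨δ, ⟨h0, h1⟩, rfl⟩

lemma le_gTilde {c v : ℝ}
    (h : ∀ δ, 0 ≤ δ → δ ≤ 1 / 2 → v ≤ max (gNIID c c - H2 δ) (δ ^ 2 * gNIID c c)) :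
    v ≤ gTilde c := by
  apply le_csInf
  · exact ⟨_, ⟨0, by norm_num, rfl⟩⟩
  · rintro _ ⟨δ, hδ, rfl⟩
    exact h δ hδ.1 hδ.2

lemma gTilde_le_quarter (c : ℝ) : gTilde c ≤ gNIID c c / 4 := by
  refine (gTilde_le (c := c) (δ := 1 / 2) (by norm_num) le_rfl).trans ?_
  have := gNIID_le_one c c
  have := gNIID_nonneg c c
  rw [H2_half]
  apply max_le <;> linarith

lemma gTilde_mono : MonotoneOn gTilde (Set.Ici 0) := by
  intro c _ c' _ h
  apply le_gTilde
  intro δ h0 h1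
  refine (gTilde_le h0 h1).trans ?_
  have := gNIID_mono h
  gcongr

lemma l_lower {x y ε : ℝ} (hx1 : x ≤ 1) (hy1 : y ≤ 1) (he : 0 < ε) (he1 : ε ≤ 1 / 16)
    (h : ε ≤ 1 - x ∨ ε ≤ 1 - y) : ε ^ 2 / (8 * Real.log 2) ≤ lfun x y := by
  have hl : 0 < Real.log 2 := Real.log_pos (by norm_num)
  apply le_lfun
  rintro a b ⟨ha, hb, ha2, hb2, hab⟩
  dsimp only at *
  have ha3 := (le_max_left _ _).trans ha2
  have hb3 := (le_max_left _ _).trans hb2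
  gcongr
  by_cases hy : 3 / 4 ≤ y
  · by_cases hxx : ε ≤ 1 - x
    · have h1 : 1 ≤ a := by linarith
      have h2 : ε ≤ (1 - x) * a := by nlinarith
      nlinarith [sq_nonneg ((1 - y) * b)]
    · have hyy : ε ≤ 1 - y := by tauto
      have h1 : 1 ≤ b := by linarith
      have h2 : ε ≤ (1 - y) * b := by nlinarith
      nlinarith [sq_nonneg ((1 - x) * a)]
  · by_cases hxx : 3 / 4 ≤ x
    · have h1 : 1 ≤ b := by linarith
      have h2 : ε ≤ (1 - y) * b := by nlinarith
      nlinarith [sq_nonneg ((1 - x) * a)]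
    · have h3 : a / 4 ≤ (1 - x) * a := by nlinarith
      have h4 : b / 4 ≤ (1 - y) * b := by nlinarith
      have h5 : 1 / 8 ≤ (1 - x) * a + (1 - y) * b := by linarith
      nlinarith [sq_nonneg ((1 - x) * a - (1 - y) * b)]

lemma gNIID_pos {c : ℝ} (hc : 0 < c) : 0 < gNIID c c := by
  have hl : 0 < Real.log 2 := Real.log_pos (by norm_num)
  have hev : ∀ᶠ x in nhds (1 : ℝ), H2 x < c / 4 :=
    (H2_cont.tendsto 1).eventually_lt_const (by rw [H2_one]; linarith)
  obtain ⟨e, he, hH⟩ := Metric.eventually_nhds_iff.1 hev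
  set ε := min (e / 2) (1 / 16) with hε
  have hε0 : 0 < ε := by positivity
  have hε1 : ε ≤ 1 / 16 := min_le_right _ _
  have hεe : ε < e := (min_le_left _ _).trans_lt (by linarith)
  have hmin : 0 < min (c / 4) (ε ^ 2 / (16 * Real.log 2)) := by positivity
  refine hmin.trans_le (le_gNIID ?_)
  intro x y hx hx1 hy hy1
  by_cases h : ε ≤ 1 - x ∨ ε ≤ 1 - y
  · refine (min_le_right _ _).trans ?_
    have h1 := l_lower hx1 hy1 hε0 hε1 h
    have h2 : lfun x y ≤ gobj c c x y := le_max_right _ _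
    have : ε ^ 2 / (16 * Real.log 2) = 1 / 2 * (ε ^ 2 / (8 * Real.log 2)) := by
      field_simp; norm_num
    rw [this]; linarith
  · push Not at h
    refine (min_le_left _ _).trans ?_
    have h1 : H2 x < c / 4 := hH (by rw [Real.dist_eq, abs_lt]; constructor <;> linarith)
    have h2 : H2 y < c / 4 := hH (by rw [Real.dist_eq, abs_lt]; constructor <;> linarith)
    have h3 : c * x - H2 x + c * y - H2 y ≤ gobj c c x y := le_max_left _ _
    have h4 : c * (1 - x) ≤ c * (1 / 16) := by gcongr; linarith
    have h5 : c * (1 - y) ≤ c * (1 / 16) := by gcongr; linarith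
    linarith

lemma gTilde_pos {c : ℝ} (hc : 0 < c) : 0 < gTilde c := by
  have hG := gNIID_pos hc
  set G := gNIID c c with hGdef
  have hev : ∀ᶠ x in nhds (0 : ℝ), H2 x < G / 2 :=
    (H2_cont.tendsto 0).eventually_lt_const (by rw [H2_zero]; linarith)
  obtain ⟨e, he, hH⟩ := Metric.eventually_nhds_iff.1 hev
  have hmin : 0 < min (G / 2) (e ^ 2 * G) := by positivity
  refine hmin.trans_le (le_gTilde ?_)
  intro δ h0 _
  by_cases h : δ < e
  · have : H2 δ < G / 2 := hH (by rw [Real.dist_eq, sub_zero, abs_of_nonneg h0]; exact h)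
    exact (min_le_left _ _).trans (le_max_of_le_left (by linarith))
  · push Not at h
    exact (min_le_right _ _).trans (le_max_of_le_right (by gcongr))

lemma gTilde_zero : gTilde 0 = 0 := by
  apply le_antisymm _ (gTilde_nonneg 0)
  have hl : lfun 1 1 ≤ 0 := by
    refine (lfun_le (a := 2) (b := 2) ?_).trans ?_
    · simp only [Tset, Set.mem_ofPred_eq]; norm_num
    · norm_num
  have h := gNIID_le (c := 0) (d := 0) (x := 1) (y := 1) zero_le_one le_rfl zero_le_one le_rfl
  have h2 : gobj 0 0 1 1 ≤ 0 := by
    unfold gobj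
    rw [H2_one]
    exact max_le (by norm_num) hl
  have := gTilde_le_quarter 0
  linarith

lemma gTilde_iff (c : ℝ) (hc : 0 ≤ c) : gTilde c = 0 ↔ c = 0 := by
  constructor
  · intro h
    by_contra hne
    exact (gTilde_pos (lt_of_le_of_ne hc (Ne.symm hne))).ne' h
  · rintro rfl
    exact gTilde_zero

open Real in
lemma phi_bound {t s B : ℝ} (ht : 0 ≤ t) (hs : 0 < s) (htB : t ≤ B) (hsB : s ≤ B) :
    negMulLog t ≤ -t * log s - (t - s) - (t - s) ^ 2 / (2 * B) := by
  have hB : 0 < B := hs.trans_le hsB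
  rcases ht.eq_or_lt with rfl | ht
  · simp only [negMulLog_zero, neg_zero, zero_mul, zero_sub, neg_sq, sub_neg_eq_add, zero_add]
    rw [sub_nonneg, div_le_iff₀ (by positivity)]
    nlinarith
  have key : ∀ u : ℝ, u = (t - s) ^ 2 / (2 * B) → u ≤ t * log (t / s) - t + s := by
    intro u hu
    have hu1 : u * (2 * B) = (t - s) ^ 2 := by rw [hu]; field_simp
    rcases le_total s t with h | h
    · have h1 := Real.le_log_one_add_of_nonneg (x := t / s - 1) (by rw [sub_nonneg, one_le_div hs]; exact h)
      rw [show 1 + (t / s - 1) = t / s by ring] at h1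
      have h2 : 2 * (t / s - 1) / (t / s - 1 + 2) = 2 * (t - s) / (t + s) := by
        field_simp; ring
      rw [h2] at h1
      have h3 : t * (2 * (t - s) / (t + s)) ≤ t * log (t / s) := by gcongr
      have h4 : t * (2 * (t - s) / (t + s)) - t + s = (t - s) ^ 2 / (t + s) := by
        field_simp; ring
      have h5 : u ≤ (t - s) ^ 2 / (t + s) := by
        rw [hu]; gcongr; linarith
      linarith
    · have h0 : 0 ≤ log (s / t) := Real.log_nonneg (by rw [one_le_div ht]; exact h)
      have h1 := Real.self_le_sinh_iff.2 h0
      rw [Real.sinh_eq, Real.exp_neg, Real.exp_log (by positivity)] at h1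
      have h2 : log (t / s) = - log (s / t) := by rw [← Real.log_inv, inv_div]
      have h3 : t * log (s / t) ≤ t * ((s / t - (s / t)⁻¹) / 2) := by gcongr
      have h4 : - (t * ((s / t - (s / t)⁻¹) / 2)) - t + s = (t - s) ^ 2 / (2 * s) := by
        field_simp; ring
      have h5 : u ≤ (t - s) ^ 2 / (2 * s) := by
        rw [hu]; gcongr
      rw [h2]
      linarith
  have h := key _ rfl
  rw [Real.log_div ht.ne' hs.ne'] at h
  simp only [negMulLog]
  linarith

open Real in
lemma tangent {t s : ℝ} (ht : 0 ≤ t) (hs : 0 < s) :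
    negMulLog t ≤ -t * log s - (t - s) := by
  have h := phi_bound ht hs (le_max_left t s) (le_max_right t s)
  have : 0 ≤ (t - s) ^ 2 / (2 * max t s) := by positivity
  linarith

open Real in
lemma js_point {P Q α l : ℝ} (hP : 0 ≤ P) (hQ : 0 ≤ Q) (h0 : 0 < α) (h1 : α < 1) :
    α * negMulLog P + (1 - α) * negMulLog Q
      + α * (1 - α) / 2 * (2 * l * |P - Q| - l ^ 2 * (P + Q))
      ≤ negMulLog (α * P + (1 - α) * Q) := by
  set M := α * P + (1 - α) * Q with hM
  have h1' : 0 < 1 - α := by linarith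
  have hM0 : 0 ≤ M := by positivity
  rcases hM0.eq_or_lt with h | h
  · have e1 : P = 0 := by
      by_contra hne
      have : 0 < P := lt_of_le_of_ne hP (Ne.symm hne)
      have : 0 < M := by positivity
      linarith
    have e2 : Q = 0 := by
      by_contra hne
      have : 0 < Q := lt_of_le_of_ne hQ (Ne.symm hne)
      have : 0 < M := by positivity
      linarith
    rw [← h, e1, e2]; simp
  · have hB : M ≤ P + Q := by nlinarith
    have hB0 : 0 < P + Q := by linarith
    have a1 := phi_bound (B := P + Q) hP h (by linarith) hB
    have a2 := phi_bound (B := P + Q) hQ h (by linarith) hB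
    have e1 : (P - M) = (1 - α) * (P - Q) := by rw [hM]; ring
    have e2 : (Q - M) = - (α * (P - Q)) := by rw [hM]; ring
    have a3 := mul_le_mul_of_nonneg_left a1 h0.le
    have a4 := mul_le_mul_of_nonneg_left a2 h1'.le
    have e3 : negMulLog M = -M * log M := rfl
    have e4 : 2 * l * |P - Q| - l ^ 2 * (P + Q) ≤ (P - Q) ^ 2 / (P + Q) := by
      rw [le_div_iff₀ hB0, ← sq_abs (P - Q)]
      nlinarith [sq_nonneg (|P - Q| - l * (P + Q))]
    have e5 : α * (1 - α) / 2 * (2 * l * |P - Q| - l ^ 2 * (P + Q)) ≤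
        α * (1 - α) / 2 * ((P - Q) ^ 2 / (P + Q)) := by gcongr
    have e6 : α * ((P - M) ^ 2 / (2 * (P + Q))) + (1 - α) * ((Q - M) ^ 2 / (2 * (P + Q)))
        = α * (1 - α) / 2 * ((P - Q) ^ 2 / (P + Q)) := by
      rw [e1, e2]; field_simp; ring
    have e7 : α * (-P * log M - (P - M)) + (1 - α) * (-Q * log M - (Q - M)) = - M * log M := by
      rw [e1, e2, hM]; ring
    rw [e3]
    linarith

lemma hasSum_cg {ι : Type*} {f g : ι → ℝ} {a : ℝ} (h : HasSum g a) (hfg : ∀ k, f k = g k) :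
    HasSum f a := by
  rw [show f = g from funext hfg]; exact h

lemma hasSum_mul2 {ι κ : Type*} {f : ι → ℝ} {g : κ → ℝ} {a b : ℝ} (hf : HasSum f a)
    (hg : HasSum g b) : HasSum (fun z : ι × κ => f z.1 * g z.2) (a * b) :=
  hf.mul hg (summable_mul_of_summable_norm hf.summable.norm hg.summable.norm)

/-- convolution on the integers -/
noncomputable def cv (f g : ℤ → ℝ) (n : ℤ) : ℝ := ∑' k, f k * g (n - k)

/-- `(n, k) ↦ (k, n - k)` -/
def shearE : ℤ × ℤ ≃ ℤ × ℤ where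
  toFun z := (z.2, z.1 - z.2)
  invFun z := (z.1 + z.2, z.1)
  left_inv z := by ext <;> simp
  right_inv z := by ext <;> simp

lemma fiber_summable {F : ℤ × ℤ → ℝ} (h : Summable F) (n : ℤ) :
    Summable (fun k => F (k, n - k)) :=
  ((shearE.summable_iff (f := F)).2 h).prod_factor n

lemma fiber_hasSum {F : ℤ × ℤ → ℝ} {a : ℝ} (h : HasSum F a) :
    HasSum (fun n => ∑' k, F (k, n - k)) a :=
  HasSum.prod_fiberwise ((shearE.hasSum_iff (f := F)).2 h)
    (fun n => (fiber_summable h.summable n).hasSum)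

lemma cv_point {f g : ℤ → ℝ} (hf : Summable f) (hg : Summable g) (n : ℤ) :
    HasSum (fun k => f k * g (n - k)) (cv f g n) :=
  (fiber_summable (hasSum_mul2 hf.hasSum hg.hasSum).summable n).hasSum

lemma cv_hasSum {f g : ℤ → ℝ} {a b : ℝ} (hf : HasSum f a) (hg : HasSum g b) :
    HasSum (cv f g) (a * b) := fiber_hasSum (hasSum_mul2 hf hg)

lemma cv_comm (f g : ℤ → ℝ) : cv f g = cv g f := by
  funext n
  unfold cv
  rw [← (Equiv.subLeft n).tsum_eq]
  congr 1
  funext k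
  simp [mul_comm]

/-- probability distribution on the integers -/
structure IsP (p : ℤ → ℝ) : Prop where
  nn : ∀ k, 0 ≤ p k
  hs : HasSum p 1

/-- probability distribution on the integers with finite entropy -/
structure IsPE (p : ℤ → ℝ) : Prop extends IsP p where
  fe : Summable (fun k => Real.negMulLog (p k))

/-- entropy in nats -/
noncomputable def ent (p : ℤ → ℝ) : ℝ := ∑' k, Real.negMulLog (p k)

lemma IsP.le_one {p : ℤ → ℝ} (hp : IsP p) (k : ℤ) : p k ≤ 1 :=
  le_hasSum hp.hs k (fun j _ => hp.nn j)

lemma IsP.eta_nonneg {p : ℤ → ℝ} (hp : IsP p) (k : ℤ) : 0 ≤ Real.negMulLog (p k) :=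
  Real.negMulLog_nonneg (hp.nn k) (hp.le_one k)

lemma IsPE.hasSum {p : ℤ → ℝ} (hp : IsPE p) : HasSum (fun k => Real.negMulLog (p k)) (ent p) :=
  hp.fe.hasSum

lemma IsP.ent_nonneg {p : ℤ → ℝ} (hp : IsP p) : 0 ≤ ent p := tsum_nonneg hp.eta_nonneg

lemma IsP.cv {p q : ℤ → ℝ} (hp : IsP p) (hq : IsP q) : IsP (cv p q) :=
  ⟨fun n => tsum_nonneg fun k => mul_nonneg (hp.nn k) (hq.nn _), by
    simpa using cv_hasSum hp.hs hq.hs⟩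

lemma cv_upper {p q : ℤ → ℝ} (hp : IsPE p) (hq : IsPE q) (n : ℤ) :
    Real.negMulLog (cv p q n) ≤
      cv (fun k => Real.negMulLog (p k)) q n + cv p (fun k => Real.negMulLog (q k)) n := by
  have h := cv_point hp.hs.summable hq.hs.summable n
  have h1 := cv_point hp.hasSum.summable hq.hs.summable n
  have h2 := cv_point hp.hs.summable hq.hasSum.summable n
  have h3 : HasSum (fun k => -(p k * q (n - k)) * Real.log (cv p q n))
    (-(cv p q n) * Real.log (cv p q n)) := (h.neg).mul_right _
  refine hasSum_le ?_ h3 (h1.add h2)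
  intro k
  have e : Real.negMulLog (p k) * q (n - k) + p k * Real.negMulLog (q (n - k)) =
      Real.negMulLog (p k * q (n - k)) := by rw [Real.negMulLog_mul]; ring
  rw [e, Real.negMulLog]
  have h0 : 0 ≤ p k * q (n - k) := mul_nonneg (hp.nn _) (hq.nn _)
  rcases h0.eq_or_lt with h0 | h0
  · rw [← h0]; simp
  · have hle : p k * q (n - k) ≤ cv p q n :=
      le_hasSum h k (fun j _ => mul_nonneg (hp.nn _) (hq.nn _))
    have := Real.log_le_log h0 hle
    nlinarith

lemma cv_lower {p q : ℤ → ℝ} (hp : IsPE p) (hq : IsP q) (n : ℤ) :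
    cv q (fun k => Real.negMulLog (p k)) n ≤ Real.negMulLog (cv q p n) := by
  have h := cv_point hq.hs.summable hp.hs.summable n
  have h1 := cv_point hq.hs.summable hp.hasSum.summable n
  have h0 : 0 ≤ cv q p n := (hq.cv hp.toIsP).nn n
  rcases h0.eq_or_lt with h0 | h0
  · rw [← h0] at h
    have hz := (hasSum_zero_iff_of_nonneg
      (fun k => mul_nonneg (hq.nn k) (hp.nn (n - k)))).1 h
    rw [← h0, Real.negMulLog_zero]
    refine le_of_eq (h1.unique ?_)
    convert hasSum_zero using 2 with k
    have := congrFun hz k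
    simp only [Pi.zero_apply, mul_eq_zero] at this
    rcases this with h | h <;> simp [h]
  · have h3 : HasSum (fun k => -(q k * p (n - k)) * Real.log (cv q p n)
        - (q k * p (n - k) - q k * cv q p n))
        (-(cv q p n) * Real.log (cv q p n) - (cv q p n - 1 * cv q p n)) :=
      ((h.neg).mul_right _).sub (h.sub (hq.hs.mul_right _))
    have h4 := hasSum_le ?_ h1 h3
    · rw [show Real.negMulLog (cv q p n) = -(cv q p n) * Real.log (cv q p n) from rfl]
      simpa using h4
    · intro k
      have := mul_le_mul_of_nonneg_left (tangent (hp.nn (n - k)) h0) (hq.nn k)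
      linarith

lemma IsPE.cv {p q : ℤ → ℝ} (hp : IsPE p) (hq : IsPE q) : IsPE (cv p q) :=
  { hp.toIsP.cv hq.toIsP with
    fe := Summable.of_nonneg_of_le (hp.toIsP.cv hq.toIsP).eta_nonneg (cv_upper hp hq)
      ((cv_hasSum hp.hasSum hq.hs).add (cv_hasSum hp.hs hq.hasSum)).summable }

lemma ent_cv_le {p q : ℤ → ℝ} (hp : IsPE p) (hq : IsPE q) : ent (cv p q) ≤ ent p + ent q := by
  have := hasSum_le (cv_upper hp hq) (hp.cv hq).hasSum
    ((cv_hasSum hp.hasSum hq.hs).add (cv_hasSum hp.hs hq.hasSum))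
  simpa using this

lemma le_ent_cv_right {p q : ℤ → ℝ} (hp : IsPE p) (hq : IsPE q) : ent q ≤ ent (cv p q) := by
  have := hasSum_le (cv_lower hq hp.toIsP) (cv_hasSum hp.hs hq.hasSum) (hp.cv hq).hasSum
  simpa using this

lemma le_ent_cv_left {p q : ℤ → ℝ} (hp : IsPE p) (hq : IsPE q) : ent p ≤ ent (cv p q) := by
  rw [cv_comm]; exact le_ent_cv_right hq hp

lemma js_sum {P Q : ℤ → ℝ} {α : ℝ} (hP : IsPE P) (hQ : IsPE Q) (h0 : 0 < α) (h1 : α < 1)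
    (hM : IsPE (fun k => α * P k + (1 - α) * Q k)) :
    α * ent P + (1 - α) * ent Q + α * (1 - α) / 4 * (∑' k, |P k - Q k|) ^ 2
      ≤ ent (fun k => α * P k + (1 - α) * Q k) := by
  have ha : HasSum (fun k => |P k - Q k|) (∑' k, |P k - Q k|) :=
    (hP.hs.summable.sub hQ.hs.summable).abs.hasSum
  set a := ∑' k, |P k - Q k|
  have hL := ((hP.hasSum.mul_left α).add (hQ.hasSum.mul_left (1 - α))).add
    (((ha.mul_left (2 * (a / 2))).sub ((hP.hs.add hQ.hs).mul_left ((a / 2) ^ 2))).mul_left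
      (α * (1 - α) / 2))
  have := hasSum_le (fun k => js_point (hP.nn k) (hQ.nn k) h0 h1) hL hM.hasSum
  refine le_trans (le_of_eq ?_) this
  ring

/-- normalized restriction -/
noncomputable def rs (q : ℤ → ℝ) (S : Set ℤ) (α : ℝ) (k : ℤ) : ℝ := S.indicator q k / α

lemma rs_hasSum_eta {q : ℤ → ℝ} (hq : IsPE q) {S : Set ℤ} {α : ℝ}
    (hS : HasSum (S.indicator q) α) (h0 : 0 < α) :
    HasSum (fun k => Real.negMulLog (rs q S α k))
      (((∑' k, S.indicator (fun k => Real.negMulLog (q k)) k) + α * Real.log α) / α) := by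
  have h := (((hq.fe.indicator S).hasSum).add (hS.mul_right (Real.log α))).div_const α
  refine hasSum_cg h fun k => ?_
  by_cases hk : k ∈ S
  · simp only [rs, hk, Set.indicator_of_mem, Real.negMulLog]
    by_cases hz : q k = 0
    · simp [hz]
    · rw [Real.log_div hz h0.ne']; field_simp; ring
  · simp [rs, hk]

lemma IsPE.rs {q : ℤ → ℝ} (hq : IsPE q) {S : Set ℤ} {α : ℝ}
    (hS : HasSum (S.indicator q) α) (h0 : 0 < α) : IsPE (rs q S α) where
  nn k := div_nonneg (Set.indicator_nonneg (fun k _ => hq.nn k) k) h0.le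
  hs := by
    have := hS.div_const α
    rwa [div_self h0.ne'] at this
  fe := (rs_hasSum_eta hq hS h0).summable

lemma compl_hasSum {q : ℤ → ℝ} (hq : IsP q) {S : Set ℤ} {α : ℝ}
    (hS : HasSum (S.indicator q) α) : HasSum (Sᶜ.indicator q) (1 - α) := by
  have := hq.hs.sub hS
  refine hasSum_cg this fun k => ?_
  by_cases hk : k ∈ S <;> simp [hk]

lemma rs_mix {q : ℤ → ℝ} {S : Set ℤ} {α : ℝ} (h0 : 0 < α) (h1 : α < 1) (k : ℤ) :
    α * rs q S α k + (1 - α) * rs q Sᶜ (1 - α) k = q k := by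
  have : 1 - α ≠ 0 := by linarith
  unfold rs
  by_cases hk : k ∈ S
  · simp [hk]; field_simp
  · simp [hk]; field_simp

lemma ent_rs {q : ℤ → ℝ} (hq : IsPE q) {S : Set ℤ} {α : ℝ}
    (hS : HasSum (S.indicator q) α) (h0 : 0 < α) (h1 : α < 1) :
    α * ent (rs q S α) + (1 - α) * ent (rs q Sᶜ (1 - α)) =
      ent q - (Real.negMulLog α + Real.negMulLog (1 - α)) := by
  have h1' : 0 < 1 - α := by linarith
  have e1 := (rs_hasSum_eta hq hS h0).tsum_eq
  have e2 := (rs_hasSum_eta hq (compl_hasSum hq.toIsP hS) h1').tsum_eq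
  have e3 : ent q = (∑' k, S.indicator (fun k => Real.negMulLog (q k)) k)
      + (∑' k, Sᶜ.indicator (fun k => Real.negMulLog (q k)) k) := by
    rw [← (hq.fe.indicator S).tsum_add (hq.fe.indicator Sᶜ)]
    unfold ent
    congr 1
    funext k
    by_cases hk : k ∈ S <;> simp [hk]
  rw [ent, ent, e1, e2, e3, Real.negMulLog, Real.negMulLog]
  field_simp
  ring

lemma cv_mix {p q : ℤ → ℝ} (hp : IsPE p) (hq : IsPE q) {S : Set ℤ} {α : ℝ}
    (hS : HasSum (S.indicator q) α) (h0 : 0 < α) (h1 : α < 1) :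
    cv p q = fun n => α * cv p (rs q S α) n + (1 - α) * cv p (rs q Sᶜ (1 - α)) n := by
  have h1' : 0 < 1 - α := by linarith
  have r1 := hq.rs hS h0
  have r2 := hq.rs (compl_hasSum hq.toIsP hS) h1'
  funext n
  refine (cv_point hp.hs.summable hq.hs.summable n).unique ?_
  refine hasSum_cg (((cv_point hp.hs.summable r1.hs.summable n).mul_left α).add
    ((cv_point hp.hs.summable r2.hs.summable n).mul_left (1 - α))) fun k => ?_
  conv_lhs => rw [← rs_mix (q := q) (S := S) h0 h1 (n - k)]
  ring

lemma gap {p q : ℤ → ℝ} (hp : IsPE p) (hq : IsPE q) {S : Set ℤ} {α : ℝ}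
    (hS : HasSum (S.indicator q) α) (h0 : 0 < α) (h1 : α < 1) :
    α * ent (cv p (rs q S α)) + (1 - α) * ent (cv p (rs q Sᶜ (1 - α)))
      + α * (1 - α) / 4 * (∑' k, |cv p (rs q S α) k - cv p (rs q Sᶜ (1 - α)) k|) ^ 2
      ≤ ent (cv p q) := by
  have h1' : 0 < 1 - α := by linarith
  have r1 := hp.cv (hq.rs hS h0)
  have r2 := hp.cv (hq.rs (compl_hasSum hq.toIsP hS) h1')
  have e := cv_mix hp hq hS h0 h1
  have := js_sum r1 r2 h0 h1 (by rw [← e]; exact hp.cv hq)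
  rwa [← e] at this

lemma gap1 {p q : ℤ → ℝ} (hp : IsPE p) (hq : IsPE q) {S : Set ℤ} {α : ℝ}
    (hS : HasSum (S.indicator q) α) (h0 : 0 < α) (h1 : α < 1) :
    ent p + α * (1 - α) / 4 * (∑' k, |cv p (rs q S α) k - cv p (rs q Sᶜ (1 - α)) k|) ^ 2
      ≤ ent (cv p q) := by
  have h1' : 0 < 1 - α := by linarith
  have r1 := le_ent_cv_left hp (hq.rs hS h0)
  have r2 := le_ent_cv_left hp (hq.rs (compl_hasSum hq.toIsP hS) h1')
  have := gap hp hq hS h0 h1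
  nlinarith

lemma atom_hasSum (q : ℤ → ℝ) (j : ℤ) : HasSum (({j} : Set ℤ).indicator q) (q j) := by
  have := hasSum_single (f := ({j} : Set ℤ).indicator q) j (by
    intro k hk; simp [hk])
  simpa using this

lemma gap2 {p q : ℤ → ℝ} (hp : IsPE p) (hq : IsPE q) (j : ℤ) (hj : 0 < q j) :
    q j * ent p + ent q - (Real.negMulLog (q j) + Real.negMulLog (1 - q j)) ≤ ent (cv p q) := by
  rcases (hq.le_one j).eq_or_lt with h1 | h1
  · have hz : ∀ k, k ≠ j → q k = 0 := by
      have hc := compl_hasSum hq.toIsP (atom_hasSum q j)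
      rw [h1, sub_self] at hc
      have := (hasSum_zero_iff_of_nonneg
        (fun k => Set.indicator_nonneg (fun k _ => hq.nn k) k)).1 hc
      intro k hk
      have h := congrFun this k
      simpa [hk] using h
    have he : ent q = 0 := by
      unfold ent
      convert tsum_zero with k
      by_cases hk : k = j
      · rw [hk, h1, Real.negMulLog_one]
      · rw [hz k hk, Real.negMulLog_zero]
    rw [h1, he]
    have := le_ent_cv_left hp hq
    simpa using this
  · have h1' : 0 < 1 - q j := by linarith
    have hS := atom_hasSum q j
    have h := gap hp hq hS hj h1
    have h2 := ent_rs hq hS hj h1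
    have r1 := le_ent_cv_left hp (hq.rs hS hj)
    have r2 := le_ent_cv_right hp (hq.rs (compl_hasSum hq.toIsP hS) h1')
    have e0 : ent (rs q {j} (q j)) = 0 := by
      unfold ent
      convert tsum_zero with k
      by_cases hk : k = j
      · simp [rs, hk, hj.ne']
      · simp [rs, hk]
    rw [e0] at h2
    have : 0 ≤ q j * (1 - q j) / 4 *
      (∑' k, |cv p (rs q {j} (q j)) k - cv p (rs q {j}ᶜ (1 - q j)) k|) ^ 2 := by positivity
    nlinarith

lemma IsP.exists_max {p : ℤ → ℝ} (hp : IsP p) : ∃ i, 0 < p i ∧ ∀ k, p k ≤ p i := by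
  obtain ⟨k0, hk0⟩ : ∃ k, 0 < p k := by
    by_contra h
    push Not at h
    have : p = fun _ => 0 := funext fun k => le_antisymm (h k) (hp.nn k)
    have h1 := hp.hs
    rw [this] at h1
    exact zero_ne_one (hasSum_zero.unique h1)
  have hfin : {k | p k0 ≤ p k}.Finite := by
    have := hp.hs.summable.tendsto_cofinite_zero.eventually_lt_const hk0
    rw [Filter.eventually_cofinite] at this
    simpa using this
  obtain ⟨i, hi, hmax⟩ := hfin.exists_maximalFor p _ ⟨k0, le_refl (p k0)⟩
  have hi' : p k0 ≤ p i := hi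
  refine ⟨i, hk0.trans_le hi', fun k => ?_⟩
  rcases le_total (p k) (p i) with h | h
  · exact h
  · exact hmax (show p k0 ≤ p k from hi'.trans h) h

/-- cumulative distribution function -/
noncomputable def cf (p : ℤ → ℝ) (m : ℤ) : ℝ := ∑' k, (Set.Iic m).indicator p k

lemma cf_hasSum {p : ℤ → ℝ} (hp : IsP p) (m : ℤ) : HasSum ((Set.Iic m).indicator p) (cf p m) :=
  (hp.hs.summable.indicator _).hasSum

lemma cut {p : ℤ → ℝ} (hp : IsP p) {x : ℝ} (hx : ∀ k, p k ≤ x) (hx1 : x < 1) :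
    ∃ m, (1 - x) / 2 ≤ cf p m ∧ cf p m ≤ (1 + x) / 2 := by
  have hx0 : 0 ≤ x := (hp.nn 0).trans (hx 0)
  have hev := hp.hs.eventually_const_lt (show (1 + x) / 2 < 1 by linarith)
  obtain ⟨s, hs⟩ := hev.exists
  obtain ⟨m, ⟨hm, hleast⟩⟩ := Int.exists_least_of_bdd (P := fun m => (1 - x) / 2 ≤ cf p m) (by
    obtain ⟨b, hb⟩ := s.bddBelow
    refine ⟨b, fun z hz => ?_⟩
    by_contra hlt
    push Not at hlt
    have hc := compl_hasSum hp (cf_hasSum hp z)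
    have := sum_le_hasSum s (fun k _ => Set.indicator_nonneg (fun k _ => hp.nn k) k) hc
    have e : ∑ i ∈ s, (Set.Iic z)ᶜ.indicator p i = ∑ i ∈ s, p i := by
      apply Finset.sum_congr rfl
      intro i hi
      have : b ≤ i := hb hi
      rw [Set.indicator_of_mem]
      simp only [Set.mem_compl_iff, Set.mem_Iic]
      omega
    linarith) (by
    obtain ⟨b, hb⟩ := s.bddAbove
    refine ⟨b, ?_⟩
    have := sum_le_hasSum s (fun k _ => Set.indicator_nonneg (fun k _ => hp.nn k) k) (cf_hasSum hp b)
    have e : ∑ i ∈ s, (Set.Iic b).indicator p i = ∑ i ∈ s, p i := by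
      apply Finset.sum_congr rfl
      intro i hi
      have : i ≤ b := hb hi
      rw [Set.indicator_of_mem]
      exact this
    linarith)
  refine ⟨m, hm, ?_⟩
  have h1 : cf p (m - 1) < (1 - x) / 2 := by
    by_contra h
    push Not at h
    have := hleast _ h
    omega
  have h2 : cf p m = cf p (m - 1) + p m := by
    refine (cf_hasSum hp m).unique (hasSum_cg ((cf_hasSum hp (m - 1)).add (atom_hasSum p m)) ?_)
    intro k
    by_cases hk : k ≤ m - 1
    · have : k ≤ m := by omega
      have : k ≠ m := by omega
      simp [Set.indicator, *]
    · by_cases hk2 : k = m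
      · simp [Set.indicator, hk2]
      · have : ¬ k ≤ m := by omega
        simp [Set.indicator, *]
  have := hx m
  linarith

lemma l1_ge {P Q : ℤ → ℝ} (hP : IsP P) (hQ : IsP Q) (N : ℤ) :
    2 * (cf P N - cf Q N) ≤ ∑' k, |P k - Q k| := by
  have h := (((cf_hasSum hP N).sub (cf_hasSum hQ N)).mul_left 2).sub (hP.hs.sub hQ.hs)
  have := hasSum_le ?_ h (hP.hs.summable.sub hQ.hs.summable).abs.hasSum
  · linarith
  · intro k
    by_cases hk : k ≤ N
    · simp [Set.indicator, hk]
      linarith [le_abs_self (P k - Q k)]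
    · simp [Set.indicator, hk]
      linarith [neg_abs_le (P k - Q k)]

/-- mass of `{k + l ≤ N}` under the product distribution -/
noncomputable def gfun (p q : ℤ → ℝ) (N : ℤ) : ℝ :=
  ∑' z : ℤ × ℤ, {z : ℤ × ℤ | z.1 + z.2 ≤ N}.indicator (fun z => p z.1 * q z.2) z

lemma gfun_hasSum {p q : ℤ → ℝ} (hp : IsP p) (hq : IsP q) (N : ℤ) :
    HasSum ({z : ℤ × ℤ | z.1 + z.2 ≤ N}.indicator (fun z => p z.1 * q z.2)) (gfun p q N) :=
  ((hasSum_mul2 hp.hs hq.hs).summable.indicator _).hasSum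

lemma cf_cv {p q : ℤ → ℝ} (hp : IsP p) (hq : IsP q) (N : ℤ) : cf (cv p q) N = gfun p q N := by
  refine (cf_hasSum (hp.cv hq) N).unique (hasSum_cg (fiber_hasSum (gfun_hasSum hp hq N)) ?_)
  intro n
  by_cases hn : n ≤ N
  · simp [Set.indicator, hn, cv]
  · simp [Set.indicator, hn]

lemma gfun_comm {p q : ℤ → ℝ} (hp : IsP p) (hq : IsP q) (N : ℤ) : gfun p q N = gfun q p N := by
  rw [← cf_cv hp hq, cv_comm, cf_cv hq hp]

lemma gfun_mix {p q : ℤ → ℝ} (hp : IsPE p) (hq : IsPE q) {S : Set ℤ} {α : ℝ}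
    (hS : HasSum (S.indicator q) α) (h0 : 0 < α) (h1 : α < 1) (N : ℤ) :
    gfun p q N = α * gfun p (rs q S α) N + (1 - α) * gfun p (rs q Sᶜ (1 - α)) N := by
  have h1' : 0 < 1 - α := by linarith
  have r1 := hq.rs hS h0
  have r2 := hq.rs (compl_hasSum hq.toIsP hS) h1'
  refine (gfun_hasSum hp.toIsP hq.toIsP N).unique (hasSum_cg
    (((gfun_hasSum hp.toIsP r1.toIsP N).mul_left α).add
    ((gfun_hasSum hp.toIsP r2.toIsP N).mul_left (1 - α))) ?_)
  intro z
  by_cases hz : z.1 + z.2 ≤ N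
  · simp only [Set.indicator, Set.mem_ofPred_eq, hz, if_true]
    conv_lhs => rw [← rs_mix (q := q) (S := S) h0 h1 z.2]
    ring
  · simp [Set.indicator, hz]

lemma gfun_nonneg {p q : ℤ → ℝ} (hp : IsP p) (hq : IsP q) (N : ℤ) : 0 ≤ gfun p q N :=
  tsum_nonneg fun _ => Set.indicator_nonneg (fun _ _ => mul_nonneg (hp.nn _) (hq.nn _)) _

lemma gfun_le_one {p q : ℤ → ℝ} (hp : IsP p) (hq : IsP q) (N : ℤ) : gfun p q N ≤ 1 := by
  have := hasSum_le ?_ (gfun_hasSum hp hq N) (hasSum_mul2 hp.hs hq.hs)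
  · simpa using this
  · exact fun z => Set.indicator_le_self' (fun _ _ => mul_nonneg (hp.nn _) (hq.nn _)) z

lemma gfun_ge {p q : ℤ → ℝ} (hp : IsP p) (hq : IsP q) {m : ℤ} (j : ℤ)
    (hm : ∀ k, p k ≠ 0 → k ≤ m) {T : Set ℤ} {t : ℝ} (hT : HasSum (T.indicator q) t)
    (hTj : ∀ l ∈ T, q l ≠ 0 → l ≤ j) : t ≤ gfun p q (m + j) := by
  have := hasSum_le ?_ (hasSum_mul2 hp.hs hT) (gfun_hasSum hp hq (m + j))
  · simpa using this
  · intro z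
    by_cases hz : p z.1 * q z.2 = 0
    · have e : p z.1 * T.indicator q z.2 = 0 := by
        by_cases h : z.2 ∈ T <;> simp [h, hz]
      rw [e]
      exact Set.indicator_nonneg (fun _ _ => mul_nonneg (hp.nn _) (hq.nn _)) z
    · have h1 := hm _ (left_ne_zero_of_mul hz)
      by_cases h : z.2 ∈ T
      · have h2 := hTj _ h (right_ne_zero_of_mul hz)
        have : z.1 + z.2 ≤ m + j := by omega
        simp [Set.indicator, h, this]
      · simp only [Set.indicator_of_notMem h, mul_zero]
        exact Set.indicator_nonneg (fun _ _ => mul_nonneg (hp.nn _) (hq.nn _)) z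

lemma gfun_le {p q : ℤ → ℝ} (hp : IsP p) (hq : IsP q) {m : ℤ} (j : ℤ)
    (hm : ∀ k, p k ≠ 0 → m < k) {T : Set ℤ} {t : ℝ} (hT : HasSum (T.indicator q) t)
    (hTj : ∀ l ∈ T, q l ≠ 0 → j ≤ l) : gfun p q (m + j) ≤ 1 - t := by
  have := hasSum_le ?_ (gfun_hasSum hp hq (m + j)) (hasSum_mul2 hp.hs (compl_hasSum hq hT))
  · simpa using this
  · intro z
    have hn : 0 ≤ p z.1 * Tᶜ.indicator q z.2 :=
      mul_nonneg (hp.nn _) (Set.indicator_nonneg (fun _ _ => hq.nn _) _)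
    by_cases hz : p z.1 * q z.2 = 0
    · by_cases h : z.1 + z.2 ≤ m + j <;> simpa [Set.indicator, h, hz] using hn
    · have h1 := hm _ (left_ne_zero_of_mul hz)
      by_cases h : z.2 ∈ T
      · have h2 := hTj _ h (right_ne_zero_of_mul hz)
        have : ¬ z.1 + z.2 ≤ m + j := by omega
        simp [Set.indicator, h, this]
      · by_cases h' : z.1 + z.2 ≤ m + j
        · simp [Set.indicator, h, h']
        · simpa [Set.indicator, h, h'] using hn

lemma rs_supp {q : ℤ → ℝ} {S : Set ℤ} {α : ℝ} {k : ℤ} (h : rs q S α k ≠ 0) : k ∈ S := by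
  by_contra hk
  exact h (by simp [rs, hk])

/-- `‖q * p₁ - q * p₂‖₁` for the two pieces of `p` cut at `m` -/
noncomputable def dist1 (q p : ℤ → ℝ) (m : ℤ) : ℝ :=
  ∑' k, |cv q (rs p (Set.Iic m) (cf p m)) k - cv q (rs p (Set.Iic m)ᶜ (1 - cf p m)) k|

lemma dist1_nonneg (q p : ℤ → ℝ) (m : ℤ) : 0 ≤ dist1 q p m := tsum_nonneg fun _ => abs_nonneg _

lemma dist1_ge {p q : ℤ → ℝ} (hp : IsPE p) (hq : IsPE q) {m : ℤ} (h0 : 0 < cf p m)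
    (h1 : cf p m < 1) (N : ℤ) :
    2 * (gfun (rs p (Set.Iic m) (cf p m)) q N - gfun (rs p (Set.Iic m)ᶜ (1 - cf p m)) q N)
      ≤ dist1 q p m := by
  have r1 := (hp.rs (cf_hasSum hp.toIsP m) h0).toIsP
  have r2 := (hp.rs (compl_hasSum hp.toIsP (cf_hasSum hp.toIsP m)) (by linarith)).toIsP
  have := l1_ge (hq.toIsP.cv r1) (hq.toIsP.cv r2) N
  rwa [cf_cv hq.toIsP r1, cf_cv hq.toIsP r2, gfun_comm hq.toIsP r1, gfun_comm hq.toIsP r2] at this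

lemma dist1_ge_atom {p q : ℤ → ℝ} (hp : IsPE p) (hq : IsPE q) {m : ℤ} (h0 : 0 < cf p m)
    (h1 : cf p m < 1) (j : ℤ) : 4 * q j - 2 ≤ dist1 q p m := by
  have r1 := (hp.rs (cf_hasSum hp.toIsP m) h0).toIsP
  have r2 := (hp.rs (compl_hasSum hp.toIsP (cf_hasSum hp.toIsP m)) (by linarith)).toIsP
  have h := dist1_ge hp hq h0 h1 (m + j)
  have a1 := gfun_ge r1 hq.toIsP j (m := m) (fun k hk => Set.mem_Iic.1 (rs_supp hk)) (atom_hasSum q j)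
    (by rintro l rfl _; exact le_rfl)
  have a2 := gfun_le r2 hq.toIsP j (m := m) (fun k hk => by simpa using rs_supp hk)
    (atom_hasSum q j) (by rintro l rfl _; exact le_rfl)
  linarith

lemma dist1_sum {p q : ℤ → ℝ} (hp : IsPE p) (hq : IsPE q) {m n : ℤ} (h0 : 0 < cf p m)
    (h1 : cf p m < 1) (h0' : 0 < cf q n) (h1' : cf q n < 1) {x y : ℝ}
    (hx : (1 - x) / 2 ≤ cf p m) (hx' : cf p m ≤ (1 + x) / 2)
    (hy : (1 - y) / 2 ≤ cf q n) (hy' : cf q n ≤ (1 + y) / 2) :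
    2 - x - y ≤ dist1 q p m + dist1 p q n := by
  have cp := cf_hasSum hp.toIsP m
  have cq := cf_hasSum hq.toIsP n
  have p1 := hp.rs cp h0
  have p2 := hp.rs (compl_hasSum hp.toIsP cp) (by linarith)
  have q1 := hq.rs cq h0'
  have q2 := hq.rs (compl_hasSum hq.toIsP cq) (by linarith)
  have a := dist1_ge hp hq h0 h1 (m + n)
  have b := dist1_ge hq hp h0' h1' (m + n)
  rw [gfun_mix p1 hq cq h0' h1', gfun_mix p2 hq cq h0' h1'] at a
  rw [gfun_mix q1 hp cp h0 h1, gfun_mix q2 hp cp h0 h1,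
    gfun_comm q1.toIsP p1.toIsP, gfun_comm q1.toIsP p2.toIsP,
    gfun_comm q2.toIsP p1.toIsP, gfun_comm q2.toIsP p2.toIsP] at b
  have g11 := gfun_ge p1.toIsP q1.toIsP n (m := m) (fun k hk => Set.mem_Iic.1 (rs_supp hk)) (T := Set.univ)
    (by simpa using q1.hs) (fun l _ hl => Set.mem_Iic.1 (rs_supp hl))
  have g22 := gfun_le p2.toIsP q2.toIsP n (m := m) (fun k hk => by simpa using rs_supp hk)
    (T := Set.univ) (by simpa using q2.hs)
    (fun l _ hl => by have : n < l := by simpa using rs_supp hl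
                      exact this.le)
  have u12 := gfun_le_one p1.toIsP q2.toIsP (m + n)
  have u21 := gfun_le_one p2.toIsP q1.toIsP (m + n)
  have l12 := gfun_nonneg p1.toIsP q2.toIsP (m + n)
  have l21 := gfun_nonneg p2.toIsP q1.toIsP (m + n)
  have u11 := gfun_le_one p1.toIsP q1.toIsP (m + n)
  have l22 := gfun_nonneg p2.toIsP q2.toIsP (m + n)
  generalize cf p m = α at *
  generalize cf q n = β at *
  have e11 := le_antisymm u11 g11
  have e22 := le_antisymm (by simpa using g22) l22
  rw [e11, e22] at a b
  generalize gfun (rs p (Set.Iic m) α) (rs q (Set.Iic n)ᶜ (1 - β)) (m + n) = g12 at *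
  generalize gfun (rs p (Set.Iic m)ᶜ (1 - α)) (rs q (Set.Iic n) β) (m + n) = g21 at *
  have hs : 2 * ((α + β) + (1 - α - β) * (g12 + g21)) ≤ dist1 q p m + dist1 p q n := by
    linarith
  rcases le_total (α + β) 1 with h | h
  · have : 0 ≤ (1 - α - β) * (g12 + g21) := mul_nonneg (by linarith) (by linarith)
    linarith
  · have : 0 ≤ (α + β - 1) * (2 - (g12 + g21)) := mul_nonneg (by linarith) (by linarith)
    linarith

lemma half_bound {p q : ℤ → ℝ} (hp : IsPE p) (hq : IsPE q) {m : ℤ} (h0 : 0 < cf p m)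
    (h1 : cf p m < 1) {x : ℝ} (hx0 : 0 ≤ x) (hx1 : x ≤ 1)
    (hx : (1 - x) / 2 ≤ cf p m) (hx' : cf p m ≤ (1 + x) / 2) :
    ent q + (1 - x) ^ 2 * dist1 q p m ^ 2 / 16 ≤ ent (cv p q) := by
  have h := gap1 hq hp (cf_hasSum hp.toIsP m) h0 h1
  rw [cv_comm q p] at h
  change ent q + cf p m * (1 - cf p m) / 4 * dist1 q p m ^ 2 ≤ ent (cv p q) at h
  have h2 : (1 - x) ^ 2 / 4 ≤ cf p m * (1 - cf p m) := by nlinarith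
  have h3 : (1 - x) ^ 2 / 4 * dist1 q p m ^ 2 ≤ cf p m * (1 - cf p m) * dist1 q p m ^ 2 := by
    gcongr
  linarith

lemma exists_ab {p q : ℤ → ℝ} (hp : IsPE p) (hq : IsPE q) {i j : ℤ} (hi : ∀ k, p k ≤ p i)
    (hj : ∀ k, q k ≤ q j) : ∃ a b, (a, b) ∈ Tset (p i) (q j) ∧
      ent q + (1 - p i) ^ 2 * a ^ 2 / 16 ≤ ent (cv p q) ∧
      ent p + (1 - q j) ^ 2 * b ^ 2 / 16 ≤ ent (cv p q) := by
  have hl := le_ent_cv_left hp hq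
  have hr := le_ent_cv_right hp hq
  have x0 := hp.nn i
  have y0 := hq.nn j
  have A : p i < 1 → ∃ m, 0 < cf p m ∧ cf p m < 1 ∧ (1 - p i) / 2 ≤ cf p m ∧
      cf p m ≤ (1 + p i) / 2 := by
    intro h
    obtain ⟨m, h1, h2⟩ := cut hp.toIsP hi h
    exact ⟨m, by linarith, by linarith, h1, h2⟩
  have B : q j < 1 → ∃ n, 0 < cf q n ∧ cf q n < 1 ∧ (1 - q j) / 2 ≤ cf q n ∧
      cf q n ≤ (1 + q j) / 2 := by
    intro h
    obtain ⟨m, h1, h2⟩ := cut hq.toIsP hj h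
    exact ⟨m, by linarith, by linarith, h1, h2⟩
  rcases (hp.le_one i).eq_or_lt with hx | hx <;> rcases (hq.le_one j).eq_or_lt with hy | hy
  · refine ⟨2, 2, ?_, ?_, ?_⟩
    · simp only [Tset, Set.mem_ofPred_eq, hx, hy]; norm_num
    · rw [hx]; simpa using hr
    · rw [hy]; simpa using hl
  · obtain ⟨n, n0, n1, n2, n3⟩ := B hy
    have hd := dist1_ge_atom hq hp n0 n1 i
    refine ⟨2, dist1 p q n, ?_, ?_, ?_⟩
    · simp only [Tset, Set.mem_ofPred_eq]
      rw [hx] at hd ⊢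
      refine ⟨by norm_num, by linarith, max_le (by linarith) (by norm_num),
        max_le (by linarith) (by linarith), by linarith⟩
    · rw [hx]; simpa using hr
    · have := half_bound hq hp n0 n1 y0 hy.le n2 n3
      rwa [cv_comm q p] at this
  · obtain ⟨n, n0, n1, n2, n3⟩ := A hx
    have hd := dist1_ge_atom hp hq n0 n1 j
    refine ⟨dist1 q p n, 2, ?_, ?_, ?_⟩
    · simp only [Tset, Set.mem_ofPred_eq]
      rw [hy] at hd ⊢
      refine ⟨by linarith, by norm_num, max_le (by linarith) (by linarith),
        max_le (by linarith) (by norm_num), by linarith⟩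
    · exact half_bound hp hq n0 n1 x0 hx.le n2 n3
    · rw [hy]; simpa using hl
  · obtain ⟨m, m0, m1, m2, m3⟩ := A hx
    obtain ⟨n, n0, n1, n2, n3⟩ := B hy
    refine ⟨dist1 q p m, dist1 p q n, ?_, ?_, ?_⟩
    · simp only [Tset, Set.mem_ofPred_eq]
      exact ⟨dist1_nonneg _ _ _, dist1_nonneg _ _ _,
        max_le (dist1_ge_atom hp hq m0 m1 j) (dist1_nonneg _ _ _),
        max_le (dist1_ge_atom hq hp n0 n1 i) (dist1_nonneg _ _ _),
        dist1_sum hp hq m0 m1 n0 n1 m2 m3 n2 n3⟩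
    · exact half_bound hp hq m0 m1 x0 hx.le m2 m3
    · have := half_bound hq hp n0 n1 y0 hy.le n2 n3
      rwa [cv_comm q p] at this

/-- entropy in bits -/
noncomputable def bent (p : ℤ → ℝ) : ℝ := ent p / Real.log 2

lemma pair_bound {p q : ℤ → ℝ} (hp : IsPE p) (hq : IsPE q) :
    gNIID (bent p) (bent q) / 2 ≤ bent (cv p q) - (bent p + bent q) / 2 := by
  have hL : 0 < Real.log 2 := Real.log_pos (by norm_num)
  obtain ⟨i, hi0, hi⟩ := hp.toIsP.exists_max
  obtain ⟨j, hj0, hj⟩ := hq.toIsP.exists_max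
  obtain ⟨a, b, hT, ha, hb⟩ := exists_ab hp hq hi hj
  have hg := gNIID_le (c := bent p) (d := bent q) hi0.le (hp.le_one i) hj0.le (hq.le_one j)
  have hl := lfun_le hT
  have A1 := gap2 hp hq j hj0
  have A2 := gap2 hq hp i hi0
  rw [cv_comm q p] at A2
  have k1 := le_ent_cv_left hp hq
  have k2 := le_ent_cv_right hp hq
  set D := bent (cv p q) - (bent p + bent q) / 2 with hD
  have hDe : D * Real.log 2 = ent (cv p q) - (ent p + ent q) / 2 := by
    rw [hD]; unfold bent; field_simp
  have hD0 : 0 ≤ D := by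
    by_contra h
    push Not at h
    have := mul_neg_of_neg_of_pos h hL
    linarith
  have f1 : gobj (bent p) (bent q) (p i) (q j) ≤ 4 * D := by
    unfold gobj
    apply max_le
    · have e : bent q * p i - H2 (p i) + bent p * q j - H2 (q j) =
          (p i * ent q - (Real.negMulLog (p i) + Real.negMulLog (1 - p i)) +
          (q j * ent p - (Real.negMulLog (q j) + Real.negMulLog (1 - q j)))) / Real.log 2 := by
        rw [H2_eq, H2_eq, Real.binEntropy_eq_negMulLog_add_negMulLog_one_sub,
          Real.binEntropy_eq_negMulLog_add_negMulLog_one_sub]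
        unfold bent
        field_simp
        ring
      rw [e, div_le_iff₀ hL]
      nlinarith
    · refine hl.trans ?_
      rw [div_le_iff₀ (by positivity)]
      linarith
  linarith

lemma pair_abs {p q : ℤ → ℝ} (hp : IsPE p) (hq : IsPE q) :
    |bent p - bent q| / 2 ≤ bent (cv p q) - (bent p + bent q) / 2 := by
  have hL : 0 < Real.log 2 := Real.log_pos (by norm_num)
  have k1 : bent p ≤ bent (cv p q) := by unfold bent; gcongr; exact le_ent_cv_left hp hq
  have k2 : bent q ≤ bent (cv p q) := by unfold bent; gcongr; exact le_ent_cv_right hp hq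
  rcases abs_cases (bent p - bent q) with h | h <;> linarith

lemma outer {w : ℤ → ℝ} {p : ℤ → ℤ → ℝ} {c : ℝ} (hw : ∀ i, 0 ≤ w i) (hw1 : HasSum w 1)
    (hp : ∀ i, IsPE (p i)) (hc : HasSum (fun i => w i * bent (p i)) c) {E : ℝ}
    (hE : HasSum (fun z : ℤ × ℤ => w z.1 * w z.2 * bent (cv (p z.1) (p z.2))) E) :
    gNIID c c / 3 ≤ E - c := by
  set G := gNIID c c with hG
  set u : ℤ → ℝ := fun i => bent (p i) - c with hu
  set s : ℤ → ℝ := fun i => if 0 ≤ u i then 1 else -1 with hs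
  have hs1 : ∀ i, |s i| = 1 := by
    intro i; simp only [hs]; split_ifs <;> simp
  have hsu : ∀ i, s i * u i = |u i| := by
    intro i; simp only [hs]; split_ifs with h
    · rw [abs_of_nonneg h, one_mul]
    · rw [abs_of_neg (not_le.1 h)]; ring
  have hwu : HasSum (fun i => w i * u i) 0 := by
    have := hc.sub (hw1.mul_right c)
    rw [one_mul, sub_self] at this
    exact hasSum_cg this fun i => by simp only [hu]; ring
  have hwa : Summable (fun i => w i * |u i|) := by
    refine hwu.summable.abs.congr fun i => ?_
    rw [abs_mul, abs_of_nonneg (hw i)]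
  obtain ⟨m, hm⟩ := hwa
  have hws : Summable (fun i => w i * s i) := by
    apply Summable.of_abs
    refine hw1.summable.congr fun i => ?_
    rw [abs_mul, hs1, mul_one, abs_of_nonneg (hw i)]
  obtain ⟨σ, hσ⟩ := hws
  have t1 := hasSum_mul2 hw1 hw1
  have t2 := hasSum_mul2 hm hw1
  have t3 := hasSum_mul2 hw1 hm
  have t4 := hasSum_mul2 hwu hw1
  have t5 := hasSum_mul2 hw1 hwu
  have t6 := hasSum_mul2 hσ hwu
  have L := ((((t1.mul_left (c + G / 3)).add (t2.mul_left (1 / 12))).sub (t3.mul_left (1 / 12))).add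
    (((t4.add t5).mul_left (7 / 12)))).sub (t6.mul_left (1 / 6))
  have key := hasSum_le ?_ L hE
  · linarith
  · rintro ⟨i, j⟩
    dsimp only
    have b1 := pair_bound (hp i) (hp j)
    have b2 := pair_abs (hp i) (hp j)
    have b3 := gNIID_lip c (bent (p i)) (bent (p j))
    have n1 : max (c - bent (p i)) 0 = (|u i| - u i) / 2 := by
      simp only [hu]
      rcases le_total c (bent (p i)) with h | h
      · rw [max_eq_right (by linarith), abs_of_nonneg (by linarith)]; ring
      · rw [max_eq_left (by linarith), abs_of_nonpos (by linarith)]; ring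
    have n2 : max (c - bent (p j)) 0 = (|u j| - u j) / 2 := by
      simp only [hu]
      rcases le_total c (bent (p j)) with h | h
      · rw [max_eq_right (by linarith), abs_of_nonneg (by linarith)]; ring
      · rw [max_eq_left (by linarith), abs_of_nonpos (by linarith)]; ring
    rw [n1, n2] at b3
    have n3 : |u i| - s i * u j ≤ |bent (p i) - bent (p j)| := by
      have e : bent (p i) - bent (p j) = u i - u j := by simp only [hu]; ring
      rw [e, ← hsu i, ← mul_sub]
      refine (le_abs_self _).trans ?_
      rw [abs_mul, hs1, one_mul]
    have e1 : bent (p i) = u i + c := by simp only [hu]; ring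
    have e2 : bent (p j) = u j + c := by simp only [hu]; ring
    have hfin : (c + G / 3) + 1 / 12 * |u i| - 1 / 12 * |u j| + 7 / 12 * (u i + u j)
        - 1 / 6 * (s i * u j) ≤ bent (cv (p i) (p j)) := by
      linarith
    have := mul_le_mul_of_nonneg_left hfin (mul_nonneg (hw i) (hw j))
    linarith

lemma hasSum_pr {Ω : Type*} [MeasurableSpace Ω] (μ : Measure Ω) [IsProbabilityMeasure μ]
    {Z : Ω → ℤ} (hZ : Measurable Z) {A : Set Ω} (hA : MeasurableSet A) :
    HasSum (fun k => pr μ (A ∩ {ω | Z ω = k})) (pr μ A) := by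
  have hU : A = ⋃ k, A ∩ {ω | Z ω = k} := by
    ext ω; simp
  have hm : ∀ k, MeasurableSet (A ∩ {ω | Z ω = k}) :=
    fun k => hA.inter (hZ (measurableSet_singleton k))
  have hd : Pairwise (Function.onFun Disjoint fun k => A ∩ {ω | Z ω = k}) := by
    intro a b hab
    rw [Function.onFun, Set.disjoint_left]
    rintro ω ⟨_, h1⟩ ⟨_, h2⟩
    exact hab (h1.symm.trans h2)
  have h := measure_iUnion (μ := μ) hd hm
  rw [← hU] at h
  have h2 := ENNReal.hasSum_toReal (f := fun k => μ (A ∩ {ω | Z ω = k}))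
    (by rw [← h]; exact measure_ne_top μ A)
  unfold pr
  rw [h, ENNReal.tsum_toReal_eq (fun k => measure_ne_top μ _)]
  exact h2

lemma term_eq (w t : ℝ) : -(w * t * Real.logb 2 (w * t / w)) =
    w * (Real.negMulLog t / Real.log 2) := by
  by_cases h : w = 0
  · simp [h]
  · rw [mul_div_cancel_left₀ _ h, Real.logb, Real.negMulLog]; ring

lemma entropy_bound {Ω : Type*} [MeasurableSpace Ω] (μ : Measure Ω) [IsProbabilityMeasure μ]
    (X Y X' Y' : Ω → ℤ) (hX : Measurable X) (hY : Measurable Y)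
    (hX' : Measurable X') (hY' : Measurable Y')
    (hindep : IndepFun (fun ω => (X ω, Y ω)) (fun ω => (X' ω, Y' ω)) μ)
    (hident : Measure.map (fun ω => (X ω, Y ω)) μ = Measure.map (fun ω => (X' ω, Y' ω)) μ)
    (c : ℝ) (hc : CondEntIs μ X Y c) :
    gNIID c c / 3 ≤ condEnt μ (fun ω => X ω + X' ω) (fun ω => (Y ω, Y' ω)) - c := by
  set w : ℤ → ℝ := fun i => pr μ {ω | Y ω = i} with hwdef
  set J : ℤ → ℤ → ℝ := fun i k => pr μ {ω | X ω = k ∧ Y ω = i} with hJdef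
  have mY : ∀ i, MeasurableSet {ω | Y ω = i} := fun i => hY (measurableSet_singleton i)
  have mY' : ∀ i, MeasurableSet {ω | Y' ω = i} := fun i => hY' (measurableSet_singleton i)
  have mX : ∀ i, MeasurableSet {ω | X ω = i} := fun i => hX (measurableSet_singleton i)
  have mX' : ∀ i, MeasurableSet {ω | X' ω = i} := fun i => hX' (measurableSet_singleton i)
  have hw : ∀ i, 0 ≤ w i := fun i => ENNReal.toReal_nonneg
  have hJ : ∀ i k, 0 ≤ J i k := fun i k => ENNReal.toReal_nonneg
  have hw1 : HasSum w 1 := by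
    have := hasSum_pr μ hY MeasurableSet.univ
    simpa [pr, hwdef] using this
  have hJw : ∀ i, HasSum (J i) (w i) := by
    intro i
    refine hasSum_cg (hasSum_pr μ hX (mY i)) fun k => ?_
    simp only [hJdef]
    congr 1
    ext ω
    simp [and_comm]
  have hpr : ∀ s : Set (ℤ × ℤ), μ ((fun ω => (X' ω, Y' ω)) ⁻¹' s) =
      μ ((fun ω => (X ω, Y ω)) ⁻¹' s) := by
    intro s
    have hs : MeasurableSet s := s.to_countable.measurableSet
    rw [← Measure.map_apply (hX'.prodMk hY') hs, ← hident, Measure.map_apply (hX.prodMk hY) hs]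
  have hind : ∀ s t : Set (ℤ × ℤ), pr μ ((fun ω => (X ω, Y ω)) ⁻¹' s ∩
      (fun ω => (X' ω, Y' ω)) ⁻¹' t) =
      pr μ ((fun ω => (X ω, Y ω)) ⁻¹' s) * pr μ ((fun ω => (X ω, Y ω)) ⁻¹' t) := by
    intro s t
    unfold pr
    rw [hindep.measure_inter_preimage_eq_mul s t s.to_countable.measurableSet
      t.to_countable.measurableSet, ENNReal.toReal_mul, hpr t]
  set p : ℤ → ℤ → ℝ := fun i k => if w i = 0 then (if k = 0 then 1 else 0) else J i k / w i
    with hpdef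
  have hJp : ∀ i k, J i k = w i * p i k := by
    intro i k
    simp only [hpdef]
    by_cases h : w i = 0
    · have h2 := le_hasSum (hJw i) k (fun j _ => hJ i j)
      rw [h] at h2 ⊢
      rw [zero_mul]
      exact le_antisymm h2 (hJ i k)
    · rw [if_neg h]; field_simp
  have hP : ∀ i, IsP (p i) := by
    intro i
    by_cases h : w i = 0
    · have e : p i = fun k => if k = 0 then 1 else 0 := by
        funext k; simp only [hpdef, h, if_true]
      rw [e]
      exact ⟨fun k => by split_ifs <;> norm_num, hasSum_ite_eq 0 1⟩
    · have e : p i = fun k => J i k / w i := by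
        funext k; simp only [hpdef, h, if_false]
      rw [e]
      refine ⟨fun k => div_nonneg (hJ i k) (hw i), ?_⟩
      have := (hJw i).div_const (w i)
      rwa [div_self h] at this
  have hc2 : HasSum (fun z : ℤ × ℤ => w z.1 * (Real.negMulLog (p z.1 z.2) / Real.log 2)) c := by
    have h := ((Equiv.prodComm ℤ ℤ).hasSum_iff (f := condEntTerm μ X Y)).2 hc
    refine hasSum_cg h fun z => ?_
    rw [← term_eq, ← hJp]
    rfl
  have hL : Real.log 2 ≠ 0 := (Real.log_pos (by norm_num)).ne'
  have hPE : ∀ i, IsPE (p i) := by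
    intro i
    refine ⟨hP i, ?_⟩
    by_cases h : w i = 0
    · have e : (fun k => Real.negMulLog (p i k)) = fun _ => 0 := by
        funext k; simp only [hpdef, h, if_true]; split_ifs <;> simp
      rw [e]; exact summable_zero
    · have h1 := hc2.summable.prod_factor i
      have h2 := h1.mul_left (Real.log 2 / w i)
      refine h2.congr fun k => ?_
      field_simp
  have hfib : ∀ i, HasSum (fun k => w i * (Real.negMulLog (p i k) / Real.log 2))
      (w i * bent (p i)) := fun i => ((hPE i).hasSum.div_const _).mul_left _
  have hc3 : HasSum (fun i => w i * bent (p i)) c := hc2.prod_fiberwise hfib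
  have hYY : ∀ i j, pr μ {ω | (Y ω, Y' ω) = (i, j)} = w i * w j := by
    intro i j
    have := hind {z | z.2 = i} {z | z.2 = j}
    simp only [hwdef]
    rw [show {ω | (Y ω, Y' ω) = (i, j)} = (fun ω => (X ω, Y ω)) ⁻¹' {z | z.2 = i} ∩
      (fun ω => (X' ω, Y' ω)) ⁻¹' {z | z.2 = j} from by ext ω; simp, this]
    rfl
  have hXX : ∀ i j n, pr μ {ω | X ω + X' ω = n ∧ (Y ω, Y' ω) = (i, j)} =
      w i * w j * cv (p i) (p j) n := by
    intro i j n
    have hmeas : MeasurableSet {ω | X ω + X' ω = n ∧ (Y ω, Y' ω) = (i, j)} :=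
      ((hX.add hX') (measurableSet_singleton n)).inter
        ((hY.prodMk hY') (measurableSet_singleton (i, j)))
    refine (hasSum_pr μ hX hmeas).unique ?_
    refine hasSum_cg ((cv_point (hP i).hs.summable (hP j).hs.summable n).mul_left (w i * w j))
      fun k => ?_
    have := hind {(k, i)} {(n - k, j)}
    rw [show {ω | X ω + X' ω = n ∧ (Y ω, Y' ω) = (i, j)} ∩ {ω | X ω = k} =
      (fun ω => (X ω, Y ω)) ⁻¹' {(k, i)} ∩ (fun ω => (X' ω, Y' ω)) ⁻¹' {(n - k, j)} from by
        ext ω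
        simp only [Set.mem_inter_iff, Set.mem_ofPred_eq, Set.mem_preimage,
          Set.mem_singleton_iff, Prod.mk.injEq]
        constructor
        · rintro ⟨⟨h1, h2, h3⟩, h4⟩
          exact ⟨⟨h4, h2⟩, by omega, h3⟩
        · rintro ⟨⟨h1, h2⟩, h3, h4⟩
          exact ⟨⟨by omega, h2, h4⟩, h1⟩, this]
    have e1 : pr μ ((fun ω => (X ω, Y ω)) ⁻¹' {(k, i)}) = J i k := by
      simp only [hJdef]; congr 1; ext ω; simp
    have e2 : pr μ ((fun ω => (X ω, Y ω)) ⁻¹' {(n - k, j)}) = J j (n - k) := by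
      simp only [hJdef]; congr 1; ext ω; simp
    rw [e1, e2, hJp, hJp]; ring
  set F : (ℤ × ℤ) × ℤ → ℝ := fun z =>
    w z.1.1 * w z.1.2 * (Real.negMulLog (cv (p z.1.1) (p z.1.2) z.2) / Real.log 2) with hF
  have hcond : condEnt μ (fun ω => X ω + X' ω) (fun ω => (Y ω, Y' ω)) = ∑' z, F z := by
    unfold condEnt
    rw [← (Equiv.prodComm (ℤ × ℤ) ℤ).tsum_eq]
    congr 1
    funext z
    obtain ⟨⟨i, j⟩, n⟩ := z
    simp only [hF, ← term_eq, condEntTerm, Equiv.prodComm_apply, Prod.swap_prod_mk]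
    rw [hXX, hYY]
  have hFfib : ∀ z : ℤ × ℤ, HasSum (fun n => F (z, n))
      (w z.1 * w z.2 * bent (cv (p z.1) (p z.2))) := fun z =>
    ((((hPE z.1).cv (hPE z.2)).hasSum).div_const _).mul_left _
  have hL0 : 0 < Real.log 2 := Real.log_pos (by norm_num)
  have hF0 : 0 ≤ F := fun z => mul_nonneg (mul_nonneg (hw _) (hw _))
    (div_nonneg (((hP _).cv (hP _)).eta_nonneg _) hL0.le)
  have hFs : Summable F := by
    rw [summable_prod_of_nonneg hF0]
    refine ⟨fun z => (hFfib z).summable, ?_⟩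
    have hb := (hasSum_mul2 hc3 hw1).add (hasSum_mul2 hw1 hc3)
    refine Summable.of_nonneg_of_le (fun z => tsum_nonneg fun n => hF0 (z, n)) ?_ hb.summable
    intro z
    rw [(hFfib z).tsum_eq]
    have h1 : bent (cv (p z.1) (p z.2)) ≤ bent (p z.1) + bent (p z.2) := by
      unfold bent
      rw [← add_div]
      gcongr
      exact ent_cv_le (hPE _) (hPE _)
    have := mul_le_mul_of_nonneg_left h1 (mul_nonneg (hw z.1) (hw z.2))
    linarith
  rw [hcond]
  exact outer hw hw1 hPE hc3 (hFs.hasSum.prod_fiberwise hFfib)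

/-- for i.i.d. pairs `(X,Y)`, `(X',Y')` of `ℤ`-valued random variables with
finite conditional entropy `H(X|Y) = c`, one has `H(X+X'|Y,Y') − c ≥ g̃(c)`; moreover `g̃` is
increasing on `[0,∞)` and `g̃(c) = 0` iff `c = 0`. -/
theorem stmt6 {Ω : Type*} [MeasurableSpace Ω] (μ : Measure Ω) [IsProbabilityMeasure μ]
    (X Y X' Y' : Ω → ℤ) (hX : Measurable X) (hY : Measurable Y)
    (hX' : Measurable X') (hY' : Measurable Y')
    (hindep : IndepFun (fun ω => (X ω, Y ω)) (fun ω => (X' ω, Y' ω)) μ)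
    (hident : Measure.map (fun ω => (X ω, Y ω)) μ = Measure.map (fun ω => (X' ω, Y' ω)) μ)
    (c : ℝ) (hc : CondEntIs μ X Y c) :
    condEnt μ (fun ω => X ω + X' ω) (fun ω => (Y ω, Y' ω)) - c ≥ gTilde c ∧
    MonotoneOn gTilde (Set.Ici 0) ∧
    (∀ c' : ℝ, 0 ≤ c' → (gTilde c' = 0 ↔ c' = 0)) := by
  refine ⟨?_, gTilde_mono, gTilde_iff⟩
  have h1 := entropy_bound μ X Y X' Y' hX hY hX' hY' hindep hident c hc
  have h2 := gTilde_le_quarter c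
  have h3 := gNIID_nonneg c c
  linarith
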